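/- Let q ∈ ℕ ∪ {∞}. If ξ ∈ ℂ with |ξ| < 1, then R_{m,n}^{q−2}(ξ) → 0 as m + n → ∞ along pairs (m,n) with m ≠ n. Moreover, if ξ = e^{iφ} with |ξ| = 1, then R_{m,n}^{q−2}(e^{iφ}) = e^{i(m−n)φ} for all m, n ∈ ℤ₊. -/

import Mathlib

open scoped ComplexOrder

noncomputable section

/-- The Hilbert space ℓ²(ℂ) of square–summable complex sequences. -/
abbrev Ell2 : Type := lp (fun _ : ℕ => ℂ) 2

/-- The Hermitian inner product of the paper: `hdot z w = z·w = Σ_j z_j conj(w_j)`. -/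
def hdot (z w : Ell2) : ℂ := @inner ℂ _ _ w z

/-- The sphere `Ω_{2q}` (for `q : ℕ∞`), viewed inside ℓ²(ℂ): the unit vectors supported
on the first `q` coordinates; for `q = ⊤` this is the unit sphere `Ω_∞` of ℓ²(ℂ). -/
def Omega (q : ℕ∞) : Set Ell2 :=
  {z | ‖z‖ = 1 ∧ ∀ j : ℕ, q ≤ (j : ℕ∞) → z j = 0}

/-- A kernel `K` is positive definite on a set `S`. -/
def IsPDKernel {α : Type*} (S : Set α) (K : α → α → ℂ) : Prop :=
  ∀ (L : ℕ) (x : Fin L → α), (∀ i, x i ∈ S) → Function.Injective x →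
    ∀ c : Fin L → ℂ, 0 ≤ ∑ μ, ∑ ν, c μ * (starRingEnd ℂ) (c ν) * K (x μ) (x ν)

/-- A kernel `K` is strictly positive definite on a set `S`. -/
def IsSPDKernel {α : Type*} (S : Set α) (K : α → α → ℂ) : Prop :=
  IsPDKernel S K ∧
    ∀ (L : ℕ) (x : Fin L → α), (∀ i, x i ∈ S) → Function.Injective x →
      ∀ c : Fin L → ℂ,
        ∑ μ, ∑ ν, c μ * (starRingEnd ℂ) (c ν) * K (x μ) (x ν) = 0 → c = 0

/-- `f` is positive definite on `Ω_{2q} × Ω_{2p}`. -/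
def PDonProd (q p : ℕ∞) (f : ℂ → ℂ → ℂ) : Prop :=
  IsPDKernel ((Omega q) ×ˢ (Omega p))
    (fun x y => f (hdot x.1 y.1) (hdot x.2 y.2))

/-- `f` is strictly positive definite on `Ω_{2q} × Ω_{2p}`. -/
def SPDonProd (q p : ℕ∞) (f : ℂ → ℂ → ℂ) : Prop :=
  IsSPDKernel ((Omega q) ×ˢ (Omega p))
    (fun x y => f (hdot x.1 y.1) (hdot x.2 y.2))

/-- `g` is positive definite on `Ω_{2q}`. -/
def PDonSphere (q : ℕ∞) (g : ℂ → ℂ) : Prop :=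
  IsPDKernel (Omega q) (fun z z' => g (hdot z z'))

/-- The Jacobi polynomial of degree `k` with (integer) parameters `α, β`, normalized
so that its value at `1` is `1`. -/
def jacobiR (α β k : ℕ) (x : ℝ) : ℝ :=
  (∑ s ∈ Finset.range (k + 1),
      ((k + α).choose (k - s) : ℝ) * ((k + β).choose s : ℝ) *
        ((x - 1) / 2) ^ s * ((x + 1) / 2) ^ (k - s)) /
    ((k + α).choose k : ℝ)

/-- The disc polynomial `R_{m,n}^{q-2}`; for `q = ⊤` (and also `q = 1`) it is
`ξ^m conj(ξ)^n`.  For `2 ≤ q < ⊤` it equals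
`r^{|m-n|} e^{i(m-n)φ} R_{min(m,n)}^{(q-2,|m-n|)}(2r²-1)` for `ξ = r e^{iφ}`. -/
def discR (q : ℕ∞) (m n : ℕ) (ξ : ℂ) : ℂ :=
  if q = ⊤ ∨ q ≤ 1 then ξ ^ m * (starRingEnd ℂ ξ) ^ n
  else (if n ≤ m then ξ ^ (m - n) else (starRingEnd ℂ ξ) ^ (n - m)) *
    ((jacobiR (q.toNat - 2) (max m n - min m n) (min m n)
        (2 * (‖ξ‖) ^ 2 - 1) : ℝ) : ℂ)

/-- The natural domain `𝔻̃`: the unit circle `∂𝔻` when `q = 1` (the sphere `Ω₂`),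
the closed unit disc `𝔻` otherwise. -/
def domD (q : ℕ∞) : Set ℂ :=
  if q = 1 then Metric.sphere (0 : ℂ) 1 else Metric.closedBall (0 : ℂ) 1

/-- `A ⊆ ℤ²` intersects every product of full arithmetic progressions in ℤ. -/
def MeetsAllProgressions (A : Set (ℤ × ℤ)) : Prop :=
  ∀ N M x y : ℤ, 0 < N → 0 < M → 0 < x → 0 < y →
    ∃ v ∈ A, (∃ j : ℤ, v.1 = N * j + x) ∧ (∃ j : ℤ, v.2 = M * j + y)

lemma integral_exp_pow_mul_exp_neg_pow (i j : ℕ) :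
    ∫ θ in (0 : ℝ)..2 * Real.pi,
        Complex.exp (θ * Complex.I) ^ i * Complex.exp (-(θ * Complex.I)) ^ j =
      if i = j then (2 * Real.pi : ℂ) else 0 := by
  have h : ∀ θ : ℝ, Complex.exp (θ * Complex.I) ^ i * Complex.exp (-(θ * Complex.I)) ^ j =
      Complex.exp ((((i : ℤ) - j : ℤ) * Complex.I) * θ) := by
    intro θ
    rw [← Complex.exp_nat_mul, ← Complex.exp_nat_mul, ← Complex.exp_add]
    congr 1; push_cast; ring
  simp_rw [h]
  split_ifs with hij
  · simp [hij]
  · have hne : (((i : ℤ) - j : ℤ) : ℂ) * Complex.I ≠ 0 := by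
      refine mul_ne_zero ?_ Complex.I_ne_zero
      rw [Int.cast_ne_zero]; omega
    rw [integral_exp_mul_complex hne]
    have : (((i : ℤ) - j : ℤ) : ℂ) * Complex.I * ((2 * Real.pi : ℝ) : ℂ) =
        ((i : ℤ) - j : ℤ) * (2 * Real.pi * Complex.I) := by push_cast; ring
    rw [this, Complex.exp_int_mul_two_pi_mul_I]
    simp

lemma integral_pow_mul_pow (r A B : ℝ) {k l : ℕ} (hkl : k ≤ l) :
    ∫ θ in (0 : ℝ)..2 * Real.pi, ((r : ℂ) + A * Complex.exp (θ * Complex.I)) ^ k *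
        (r - B * Complex.exp (-(θ * Complex.I))) ^ l =
      2 * Real.pi * ((∑ s ∈ Finset.range (k + 1),
        (k.choose s : ℝ) * (l.choose s : ℝ) * (-(A * B)) ^ s *
          (r ^ (k - s) * r ^ (l - s)) : ℝ) : ℂ) := by
  have h : ∀ θ : ℝ, ((r : ℂ) + A * Complex.exp (θ * Complex.I)) ^ k *
        (r - B * Complex.exp (-(θ * Complex.I))) ^ l =
      ∑ i ∈ Finset.range (k + 1), ∑ j ∈ Finset.range (l + 1),
        ((k.choose i : ℂ) * (l.choose j : ℂ) * A ^ i * (-B) ^ j * (r ^ (k - i) * r ^ (l - j))) *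
        (Complex.exp (θ * Complex.I) ^ i * Complex.exp (-(θ * Complex.I)) ^ j) := by
    intro θ
    rw [add_comm, sub_eq_add_neg, add_comm (r : ℂ), ← neg_mul, add_pow, add_pow,
      Finset.sum_mul_sum]
    refine Finset.sum_congr rfl fun i _ => Finset.sum_congr rfl fun j _ => ?_
    rw [mul_pow, mul_pow]; ring
  simp_rw [h]
  rw [intervalIntegral.integral_finsetSum
    (fun i _ => Continuous.intervalIntegrable (by fun_prop) _ _)]
  push_cast
  rw [Finset.mul_sum]
  refine Finset.sum_congr rfl fun i hi => ?_
  rw [intervalIntegral.integral_finsetSum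
    (fun i _ => Continuous.intervalIntegrable (by fun_prop) _ _)]
  simp_rw [intervalIntegral.integral_const_mul, integral_exp_pow_mul_exp_neg_pow]
  have hi' : i < l + 1 := by have := Finset.mem_range.mp hi; omega
  simp only [mul_ite, mul_zero, Finset.sum_ite_eq, Finset.mem_range, hi', if_true]
  rw [show -((A : ℂ) * B) = A * -B by ring, mul_pow]
  ring

lemma mul_exp_one_sub_le_one (x : ℝ) : x * Real.exp (1 - x) ≤ 1 := by
  have h := Real.add_one_le_exp (x - 1)
  have h2 : Real.exp (x - 1) * Real.exp (1 - x) = 1 := by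
    rw [← Real.exp_add]; simp
  nlinarith [Real.exp_pos (1 - x)]

lemma exists_mul_exp_one_sub_le {η : ℝ} (hη : 0 < η) :
    ∃ κ : ℝ, 0 ≤ κ ∧ κ < 1 ∧ ∀ x : ℝ, 0 ≤ x → η ≤ |x - 1| → x * Real.exp (1 - x) ≤ κ := by
  refine ⟨1 / (1 + η ^ 2 / (4 * (1 + η))), by positivity, ?_, fun x hx hxη => ?_⟩
  · rw [div_lt_one (by positivity)]
    have : 0 < η ^ 2 / (4 * (1 + η)) := by positivity
    linarith
  have h1 : 1 + η ^ 2 / (4 * (1 + η)) = (4 * (1 + η) + η ^ 2) / (4 * (1 + η)) := by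
    field_simp
  have h2 : (x + 1) ^ 2 / 4 ≤ Real.exp (x - 1) := by
    have h := Real.add_one_le_exp ((x - 1) / 2)
    have h3 : Real.exp (x - 1) = Real.exp ((x - 1) / 2) ^ 2 := by
      rw [← Real.exp_nat_mul]; congr 1; push_cast; ring
    rw [h3]; nlinarith
  have h3 : Real.exp (1 - x) = 1 / Real.exp (x - 1) := by
    rw [one_div, ← Real.exp_neg]; congr 1; ring
  rw [h1, h3, one_div_div, mul_one_div, div_le_div_iff₀ (Real.exp_pos _) (by positivity)]
  have h4 : x * (4 * (1 + η) + η ^ 2) ≤ (1 + η) * (x + 1) ^ 2 := by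
    rcases le_abs.mp hxη with h | h
    · nlinarith [mul_nonneg (sub_nonneg.mpr h) hη.le, mul_nonneg (mul_nonneg (sub_nonneg.mpr h) hη.le) hx]
    · have : η ≤ 1 := by linarith
      nlinarith [mul_nonneg (sub_nonneg.mpr h) hη.le, mul_nonneg (mul_nonneg (sub_nonneg.mpr h) hη.le) hx]
  nlinarith

lemma sq_sub_le_abs_cos_sub_cos {s t : ℝ} (hs : 0 ≤ s) (hst : s ≤ t) (ht : t ≤ Real.pi) :
    2 * ((t - s) / Real.pi) ^ 2 ≤ |Real.cos s - Real.cos t| := by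
  have hπ := Real.pi_pos
  rw [Real.cos_sub_cos]
  have e : -2 * Real.sin ((s + t) / 2) * Real.sin ((s - t) / 2) =
      2 * (Real.sin ((s + t) / 2) * Real.sin ((t - s) / 2)) := by
    rw [show (s - t) / 2 = -((t - s) / 2) by ring, Real.sin_neg]; ring
  rw [e]
  have h1 : (t - s) / Real.pi ≤ Real.sin ((t - s) / 2) := by
    have := Real.mul_le_sin (x := (t - s) / 2) (by linarith) (by linarith)
    calc _ = 2 / Real.pi * ((t - s) / 2) := by ring
      _ ≤ _ := this
  have h0 : 0 ≤ (t - s) / Real.pi := div_nonneg (by linarith) hπ.le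
  have h2 : (t - s) / Real.pi ≤ Real.sin ((s + t) / 2) := by
    rcases le_total ((s + t) / 2) (Real.pi / 2) with h | h
    · have := Real.mul_le_sin (x := (s + t) / 2) (by linarith) h
      refine le_trans ?_ this
      rw [show 2 / Real.pi * ((s + t) / 2) = (s + t) / Real.pi by ring]
      gcongr; linarith
    · have := Real.mul_le_sin (x := Real.pi - (s + t) / 2) (by linarith) (by linarith)
      rw [Real.sin_pi_sub] at this
      refine le_trans ?_ this
      rw [show 2 / Real.pi * (Real.pi - (s + t) / 2) = (2 * Real.pi - (s + t)) / Real.pi by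
        field_simp]
      exact div_le_div_of_nonneg_right (by linarith) hπ.le
  refine le_trans ?_ (le_abs_self _)
  rw [sq]
  have := mul_le_mul h2 h1 h0 (h0.trans h2)
  linarith

lemma norm_integral_le_of_abs_cos_sub {F : ℝ → ℂ} (hF1 : ∀ θ, ‖F θ‖ ≤ 1)
    {c δ ε : ℝ} (hε : 0 ≤ ε) (h : ∀ θ, δ ≤ |Real.cos θ - c| → ‖F θ‖ ≤ ε) :
    ‖∫ θ in (0 : ℝ)..Real.pi, F θ‖ ≤ Real.pi * (ε + Real.sqrt δ) := by
  have hπ := Real.pi_pos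
  set E : Set ℝ := Set.Ioc 0 Real.pi ∩ {θ | |Real.cos θ - c| < δ} with hE
  have hEm : MeasurableSet E := measurableSet_Ioc.inter
    (isOpen_lt (by fun_prop) continuous_const).measurableSet
  have hdist : ∀ s ∈ E, ∀ t ∈ E, s ≤ t → t - s ≤ Real.pi * Real.sqrt δ := by
    rintro s ⟨hs, hsc⟩ t ⟨ht, htc⟩ hst
    have h1 := sq_sub_le_abs_cos_sub_cos hs.1.le hst ht.2
    have h2 : |Real.cos s - Real.cos t| ≤ 2 * δ := by
      have := abs_sub_le (Real.cos s) c (Real.cos t)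
      rw [abs_sub_comm c] at this
      rw [Set.mem_ofPred_eq] at hsc htc
      linarith
    have h3 : (t - s) / Real.pi ≤ Real.sqrt δ := Real.le_sqrt_of_sq_le (by linarith)
    rwa [div_le_iff₀ hπ, mul_comm] at h3
  have hvol : MeasureTheory.volume.real E ≤ Real.pi * Real.sqrt δ := by
    have : MeasureTheory.volume E ≤ ENNReal.ofReal (Real.pi * Real.sqrt δ) := by
      refine (Real.volume_le_diam E).trans (Metric.ediam_le fun s hs t ht => ?_)
      rw [edist_dist]
      refine ENNReal.ofReal_le_ofReal ?_
      rw [Real.dist_eq]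
      rcases le_total s t with hst | hst
      · rw [abs_sub_comm, abs_of_nonneg (by linarith)]; exact hdist s hs t ht hst
      · rw [abs_of_nonneg (by linarith)]; exact hdist t ht s hs hst
    exact ENNReal.toReal_le_of_le_ofReal (by positivity) this
  have hEfin : MeasureTheory.volume E ≠ ⊤ :=
    ((MeasureTheory.measure_mono Set.inter_subset_left).trans_lt measure_Ioc_lt_top).ne
  rw [intervalIntegral.integral_of_le hπ.le]
  have hi1 : MeasureTheory.IntegrableOn (fun _ : ℝ => ε) (Set.Ioc 0 Real.pi) :=
    MeasureTheory.integrableOn_const measure_Ioc_lt_top.ne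
  have hi2 : MeasureTheory.IntegrableOn (E.indicator fun _ : ℝ => (1 : ℝ)) (Set.Ioc 0 Real.pi) :=
    (MeasureTheory.integrable_indicator_iff hEm |>.mpr
      (MeasureTheory.integrableOn_const hEfin)).integrableOn
  calc ‖∫ θ in Set.Ioc 0 Real.pi, F θ‖
      ≤ ∫ θ in Set.Ioc 0 Real.pi, (ε + E.indicator (fun _ => (1 : ℝ)) θ) := by
        refine MeasureTheory.norm_integral_le_of_norm_le (hi1.add hi2) ?_
        filter_upwards [MeasureTheory.ae_restrict_mem measurableSet_Ioc] with θ hθ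
        by_cases hθE : θ ∈ E
        · rw [Set.indicator_of_mem hθE]; linarith [hF1 θ]
        · rw [Set.indicator_of_notMem hθE, add_zero]
          refine h θ (not_lt.mp fun hlt => hθE ⟨hθ, hlt⟩)
    _ = Real.pi * ε + MeasureTheory.volume.real E := by
        rw [MeasureTheory.integral_add hi1 hi2, MeasureTheory.setIntegral_indicator hEm,
          Set.inter_eq_right.mpr Set.inter_subset_left]
        simp [hπ.le, hE]
    _ ≤ _ := by linarith

/-- The polynomial in `v` that equals `r ^ β * jacobiR α β k (2 * r ^ 2 - 1)` at `v = 1 - r ^ 2`. -/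
def discSum (α k β : ℕ) (r v : ℝ) : ℝ :=
  ∑ s ∈ Finset.range (k + 1), (k.choose s : ℝ) * ((k + β).choose s : ℝ) /
    ((α + s).choose s : ℝ) * (-v) ^ s * (r ^ (k - s) * r ^ (k + β - s))

lemma choose_mul_choose_eq {α k s : ℕ} (hs : s ≤ k) :
    (k + α).choose (k - s) * (α + s).choose s = k.choose s * (k + α).choose k := by
  obtain ⟨d, rfl⟩ := Nat.exists_eq_add_of_le hs
  have h1 := Nat.choose_mul (n := s + d + α) (k := α + s) (s := s) (by omega)
  have h2 := Nat.choose_mul (n := s + d + α) (k := s + d) (s := s) (by omega)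
  have e1 : (s + d + α).choose (s + d - s) = (s + d + α).choose (α + s) := by
    rw [← Nat.choose_symm (n := s + d + α) (k := α + s) (by omega)]; congr 1; omega
  rw [e1, h1, mul_comm ((s + d).choose s), h2]
  congr 1
  rw [← Nat.choose_symm (n := s + d + α - s) (k := s + d - s) (by omega)]; congr 1; omega

lemma pow_mul_jacobiR (α β k : ℕ) (r : ℝ) :
    r ^ β * jacobiR α β k (2 * r ^ 2 - 1) = discSum α k β r (1 - r ^ 2) := by
  unfold jacobiR discSum
  rw [Finset.sum_div, Finset.mul_sum]
  refine Finset.sum_congr rfl fun s hs => ?_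
  have hs' : s ≤ k := Nat.lt_succ_iff.mp (Finset.mem_range.mp hs)
  have hc : ((k + α).choose (k - s) : ℝ) * ((α + s).choose s : ℝ) =
      (k.choose s : ℝ) * ((k + α).choose k : ℝ) := by
    exact_mod_cast choose_mul_choose_eq hs'
  have h1 : ((α + s).choose s : ℝ) ≠ 0 := by
    exact_mod_cast (Nat.choose_pos (by omega)).ne'
  have h2 : ((k + α).choose k : ℝ) ≠ 0 := by
    exact_mod_cast (Nat.choose_pos (by omega)).ne'
  have e : r ^ (k - s) * r ^ (k + β - s) = r ^ β * (r ^ 2) ^ (k - s) := by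
    rw [← pow_mul, ← pow_add, ← pow_add]; congr 1; omega
  rw [e, show (2 * r ^ 2 - 1 - 1) / 2 = -(1 - r ^ 2) by ring,
    show (2 * r ^ 2 - 1 + 1) / 2 = r ^ 2 by ring]
  have h3 : ((k + α).choose (k - s) : ℝ) / ((k + α).choose k : ℝ) =
      (k.choose s : ℝ) / ((α + s).choose s : ℝ) := by
    rw [div_eq_div_iff h2 h1, hc]
  calc _ = ((k + α).choose (k - s) : ℝ) / ((k + α).choose k : ℝ) * ((k + β).choose s : ℝ) *
        (-(1 - r ^ 2)) ^ s * (r ^ β * (r ^ 2) ^ (k - s)) := by ring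
    _ = _ := by rw [h3]; ring

lemma discSum_succ (α k β : ℕ) (r v : ℝ) :
    discSum (α + 1) k β r v = ∫ t in (0 : ℝ)..1, (α + 1) * t ^ α * discSum α k β r (v * t) := by
  unfold discSum
  simp_rw [Finset.mul_sum]
  rw [intervalIntegral.integral_finsetSum
    (fun i _ => Continuous.intervalIntegrable (by fun_prop) _ _)]
  refine Finset.sum_congr rfl fun s _ => ?_
  have e : ∀ t : ℝ, (α + 1) * t ^ α * ((k.choose s : ℝ) * ((k + β).choose s : ℝ) /
      ((α + s).choose s : ℝ) * (-(v * t)) ^ s * (r ^ (k - s) * r ^ (k + β - s))) =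
      ((α + 1) * ((k.choose s : ℝ) * ((k + β).choose s : ℝ) /
      ((α + s).choose s : ℝ) * (-v) ^ s * (r ^ (k - s) * r ^ (k + β - s)))) * t ^ (α + s) := by
    intro t
    rw [show -(v * t) = -v * t by ring, mul_pow, pow_add]; ring
  simp_rw [e]
  rw [intervalIntegral.integral_const_mul, integral_pow]
  have hc : ((α + 1 + s).choose s : ℝ) * (α + 1) = ((α + s).choose s : ℝ) * (α + s + 1) := by
    have := Nat.choose_mul_succ_eq (α + s) s
    rw [show α + s + 1 - s = α + 1 by omega, show α + s + 1 = α + 1 + s by omega] at this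
    have h' : ((α + s).choose s : ℝ) * ((α + 1 + s : ℕ) : ℝ) =
      ((α + 1 + s).choose s : ℝ) * ((α + 1 : ℕ) : ℝ) := by exact_mod_cast this
    push_cast at h'
    linarith
  have h1 : ((α + s).choose s : ℝ) ≠ 0 := by
    exact_mod_cast (Nat.choose_pos (by omega)).ne'
  have h2 : ((α + 1 + s).choose s : ℝ) ≠ 0 := by
    exact_mod_cast (Nat.choose_pos (by omega)).ne'
  have h3 : ((α : ℝ) + s + 1) ≠ 0 := by positivity
  have h4 : 1 / ((α + 1 + s).choose s : ℝ) =
      (α + 1) / (((α + s).choose s : ℝ) * (α + s + 1)) := by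
    rw [div_eq_div_iff h2 (mul_ne_zero h1 h3), ← hc]; ring
  push_cast
  rw [one_pow, zero_pow (by omega), sub_zero]
  calc _ = (k.choose s : ℝ) * ((k + β).choose s : ℝ) * (1 / ((α + 1 + s).choose s : ℝ)) *
        (-v) ^ s * (r ^ (k - s) * r ^ (k + β - s)) := by ring
    _ = _ := by rw [h4]; field_simp

lemma integral_eq_discSum_zero (k β : ℕ) (r A B : ℝ) :
    ∫ θ in (0 : ℝ)..2 * Real.pi, ((r : ℂ) + A * Complex.exp (θ * Complex.I)) ^ k *
        (r - B * Complex.exp (-(θ * Complex.I))) ^ (k + β) =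
      2 * Real.pi * (discSum 0 k β r (A * B) : ℂ) := by
  rw [integral_pow_mul_pow r A B (Nat.le_add_right k β)]
  simp [discSum]

lemma norm_sq_add_mul_exp (r A θ : ℝ) :
    ‖(r : ℂ) + A * Complex.exp (θ * Complex.I)‖ ^ 2 = r ^ 2 + A ^ 2 + 2 * r * A * Real.cos θ := by
  rw [← Complex.normSq_eq_norm_sq, Complex.normSq_apply]
  simp only [Complex.add_re, Complex.add_im, Complex.re_ofReal_mul, Complex.im_ofReal_mul,
    Complex.exp_ofReal_mul_I_re, Complex.exp_ofReal_mul_I_im, Complex.ofReal_re, Complex.ofReal_im]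
  nlinarith [Real.sin_sq_add_cos_sq θ]

lemma norm_sq_sub_mul_exp_neg (r B θ : ℝ) :
    ‖(r : ℂ) - B * Complex.exp (-(θ * Complex.I))‖ ^ 2 =
      r ^ 2 + B ^ 2 - 2 * r * B * Real.cos θ := by
  have := norm_sq_add_mul_exp r (-B) (-θ)
  rw [Real.cos_neg] at this
  convert this using 2
  · congr 1; push_cast; ring_nf
  · ring

/-- If `k x + l y ≤ k + l`, then `x ^ k * y ^ l` is controlled by `x` alone. -/
lemma pow_mul_pow_le {x y : ℝ} {k l : ℕ} (hx : 0 ≤ x) (hy : 0 ≤ y)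
    (h : k * x + l * y ≤ k + l) : x ^ k * y ^ l ≤ (x * Real.exp (1 - x)) ^ k := by
  rw [mul_pow]
  gcongr
  calc y ^ l ≤ Real.exp (y - 1) ^ l := by
        gcongr; linarith [Real.add_one_le_exp (y - 1)]
    _ = Real.exp (l * (y - 1)) := (Real.exp_nat_mul _ _).symm
    _ ≤ Real.exp (k * (1 - x)) := Real.exp_le_exp.mpr (by linarith)
    _ = _ := Real.exp_nat_mul _ _

lemma norm_sq_integrand_le {r v A B : ℝ} {k β : ℕ} (hv : r ^ 2 + v ≤ 1) (hAB : A * B = v)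
    (hk : (k : ℝ) * A = (k + β : ℕ) * B) (θ : ℝ) :
    ‖((r : ℂ) + A * Complex.exp (θ * Complex.I)) ^ k *
        (r - B * Complex.exp (-(θ * Complex.I))) ^ (k + β)‖ ^ 2 ≤
      ((r ^ 2 + A ^ 2 + 2 * r * A * Real.cos θ) *
        Real.exp (1 - (r ^ 2 + A ^ 2 + 2 * r * A * Real.cos θ))) ^ k := by
  rw [norm_mul, norm_pow, norm_pow, mul_pow, ← pow_mul, ← pow_mul, mul_comm k, mul_comm (k + β),
    pow_mul, pow_mul, norm_sq_add_mul_exp, norm_sq_sub_mul_exp_neg]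
  refine pow_mul_pow_le ?_ ?_ ?_
  · rw [← norm_sq_add_mul_exp]; positivity
  · rw [← norm_sq_sub_mul_exp_neg]; positivity
  · have e : (k : ℝ) * (r ^ 2 + A ^ 2 + 2 * r * A * Real.cos θ) +
        (k + β : ℕ) * (r ^ 2 + B ^ 2 - 2 * r * B * Real.cos θ) =
        ((k : ℝ) + (k + β : ℕ)) * (r ^ 2 + v) := by
      linear_combination (A + 2 * r * Real.cos θ - B) * hk + ((k : ℝ) + (k + β : ℕ)) * hAB
    rw [e]
    exact mul_le_of_le_one_right (by positivity) hv

lemma norm_integrand_le_one {r v A B : ℝ} {k β : ℕ} (hv : r ^ 2 + v ≤ 1) (hAB : A * B = v)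
    (hk : (k : ℝ) * A = (k + β : ℕ) * B) (θ : ℝ) :
    ‖((r : ℂ) + A * Complex.exp (θ * Complex.I)) ^ k *
        (r - B * Complex.exp (-(θ * Complex.I))) ^ (k + β)‖ ≤ 1 := by
  have h := norm_sq_integrand_le hv hAB hk θ
  have h2 := pow_le_one₀ (n := k) (a := (r ^ 2 + A ^ 2 + 2 * r * A * Real.cos θ) *
    Real.exp (1 - (r ^ 2 + A ^ 2 + 2 * r * A * Real.cos θ)))
    (mul_nonneg (by rw [← norm_sq_add_mul_exp]; positivity) (Real.exp_pos _).le)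
    (mul_exp_one_sub_le_one _)
  exact (sq_le_one_iff₀ (norm_nonneg _)).mp (h.trans h2)

lemma exists_radii {v : ℝ} (hv : 0 < v) {k : ℕ} (hk : 0 < k) (β : ℕ) :
    ∃ A B : ℝ, Real.sqrt v ≤ A ∧ A * B = v ∧ (k : ℝ) * A = (k + β : ℕ) * B := by
  have hk' : (0 : ℝ) < k := by exact_mod_cast hk
  have hl : (0 : ℝ) < (k + β : ℕ) := by positivity
  have h1 : Real.sqrt (v * (k + β : ℕ) / k) ^ 2 = v * (k + β : ℕ) / k :=
    Real.sq_sqrt (by positivity)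
  refine ⟨Real.sqrt (v * (k + β : ℕ) / k), k * Real.sqrt (v * (k + β : ℕ) / k) / (k + β : ℕ),
    ?_, ?_, ?_⟩
  · apply Real.sqrt_le_sqrt
    rw [le_div_iff₀ hk']
    push_cast
    nlinarith [mul_nonneg hv.le (Nat.cast_nonneg (α := ℝ) β)]
  · calc _ = k * Real.sqrt (v * (k + β : ℕ) / k) ^ 2 / (k + β : ℕ) := by ring
      _ = v := by rw [h1]; field_simp
  · field_simp

lemma abs_discSum_zero_le_one {r v : ℝ} (hv : 0 < v) (hrv : r ^ 2 + v ≤ 1) {k : ℕ} (hk : 0 < k)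
    (β : ℕ) : |discSum 0 k β r v| ≤ 1 := by
  obtain ⟨A, B, -, hAB, hkA⟩ := exists_radii hv hk β
  have h := integral_eq_discSum_zero k β r A B
  rw [hAB] at h
  have h2 := intervalIntegral.norm_integral_le_of_norm_le_const (a := 0) (b := 2 * Real.pi)
    fun θ _ => norm_integrand_le_one hrv hAB hkA θ
  rw [h, norm_mul] at h2
  simp only [norm_mul, Complex.norm_real, Real.norm_eq_abs, Complex.norm_ofNat, sub_zero, abs_mul,
    Nat.abs_ofNat, abs_of_pos Real.pi_pos, one_mul] at h2
  nlinarith [Real.pi_pos]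

lemma exists_abs_discSum_zero_le {r v : ℝ} (hr : 0 < r) (hv : 0 < v) (hrv : r ^ 2 + v ≤ 1) {ε : ℝ}
    (hε : 0 < ε) : ∃ K : ℕ, ∀ k, K ≤ k → ∀ β, |discSum 0 k β r v| ≤ 2 * ε := by
  have hsv : 0 < Real.sqrt v := Real.sqrt_pos.mpr hv
  obtain ⟨κ, hκ0, hκ1, hκ⟩ := exists_mul_exp_one_sub_le (η := 2 * r * Real.sqrt v * ε ^ 2)
    (by positivity)
  obtain ⟨K, hK⟩ := exists_pow_lt_of_lt_one (show 0 < ε ^ 2 by positivity) hκ1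
  refine ⟨K + 1, fun k hk β => ?_⟩
  obtain ⟨A, B, hA, hAB, hkA⟩ := exists_radii hv (show 0 < k by omega) β
  have hA0 : 0 < A := hsv.trans_le hA
  set F : ℝ → ℂ := fun θ => ((r : ℂ) + A * Complex.exp (θ * Complex.I)) ^ k *
        (r - B * Complex.exp (-(θ * Complex.I))) ^ (k + β) with hF
  have hFc : Continuous F := by fun_prop
  have hF1 : ∀ θ, ‖F θ‖ ≤ 1 := norm_integrand_le_one hrv hAB hkA
  set c : ℝ := (1 - r ^ 2 - A ^ 2) / (2 * r * A) with hc
  have hFε : ∀ θ, ε ^ 2 ≤ |Real.cos θ - c| → ‖F θ‖ ≤ ε := by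
    intro θ hθ
    have hx : r ^ 2 + A ^ 2 + 2 * r * A * Real.cos θ - 1 = 2 * r * A * (Real.cos θ - c) := by
      rw [hc]; field_simp; ring
    have hx0 : 0 ≤ r ^ 2 + A ^ 2 + 2 * r * A * Real.cos θ := by
      rw [← norm_sq_add_mul_exp]; positivity
    have h1 := hκ _ hx0 (by
      rw [hx, abs_mul, abs_of_pos (by positivity)]; gcongr)
    have h2 := norm_sq_integrand_le hrv hAB hkA θ
    refine le_of_sq_le_sq ?_ hε.le
    calc _ ≤ _ := h2
      _ ≤ κ ^ k := by
        gcongr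
      _ ≤ κ ^ K := pow_le_pow_of_le_one hκ0 hκ1.le (by omega)
      _ ≤ _ := hK.le
  have hI1 := norm_integral_le_of_abs_cos_sub hF1 hε.le hFε
  have hI2 := norm_integral_le_of_abs_cos_sub (F := fun θ => F (θ + Real.pi)) (c := -c)
    (fun θ => hF1 _) hε.le fun θ hθ => hFε _ (by
      rw [Real.cos_add_pi, ← abs_neg]; convert hθ using 2; ring)
  rw [intervalIntegral.integral_comp_add_right] at hI2
  rw [Real.sqrt_sq hε.le] at hI1 hI2
  have h := integral_eq_discSum_zero k β r A B
  rw [hAB] at h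
  change ∫ θ in (0 : ℝ)..2 * Real.pi, F θ = _ at h
  rw [← intervalIntegral.integral_add_adjacent_intervals (b := Real.pi)
    (hFc.intervalIntegrable _ _) (hFc.intervalIntegrable _ _)] at h
  have h2 := norm_add_le (∫ θ in (0 : ℝ)..Real.pi, F θ) (∫ θ in Real.pi..2 * Real.pi, F θ)
  rw [zero_add, ← two_mul] at hI2
  rw [h] at h2
  simp only [norm_mul, Complex.norm_real, Real.norm_eq_abs, Complex.norm_ofNat,
    abs_of_pos Real.pi_pos] at h2
  have h3 : 2 * Real.pi * |discSum 0 k β r v| ≤ 2 * Real.pi * (2 * ε) := by linarith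
  exact le_of_mul_le_mul_left h3 (by positivity)

open Filter Topology in
lemma discSum_tendsto {r : ℝ} (hr : 0 < r) (α : ℕ) : ∀ v : ℝ, 0 < v → r ^ 2 + v ≤ 1 →
    (∀ k, 0 < k → ∀ β, |discSum α k β r v| ≤ 1) ∧
    Tendsto (fun p : ℕ × ℕ => discSum α p.1 p.2 r v) (comap Prod.fst atTop) (𝓝 0) := by
  induction α with
  | zero =>
    refine fun v hv hrv => ⟨fun k hk β => abs_discSum_zero_le_one hv hrv hk β, ?_⟩
    rw [Metric.tendsto_nhds]
    intro ε hε
    obtain ⟨K, hK⟩ := exists_abs_discSum_zero_le hr hv hrv (show 0 < ε / 4 by positivity)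
    filter_upwards [tendsto_comap.eventually (eventually_ge_atTop K)] with p hp
    rw [Real.dist_eq, sub_zero]
    linarith [hK p.1 hp p.2]
  | succ α ih =>
    intro v hv hrv
    have hvt : ∀ t ∈ Set.Ioc (0 : ℝ) 1, 0 < v * t ∧ r ^ 2 + v * t ≤ 1 := fun t ht =>
      ⟨mul_pos hv ht.1, by nlinarith [ht.2]⟩
    have hint : ∫ t in (0 : ℝ)..1, ((α : ℝ) + 1) * t ^ α = 1 := by
      rw [intervalIntegral.integral_const_mul, integral_pow]
      field_simp
      simp
    have hii : IntervalIntegrable (fun t : ℝ => ((α : ℝ) + 1) * t ^ α) MeasureTheory.volume 0 1 :=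
      Continuous.intervalIntegrable (by fun_prop) _ _
    have hbound : ∀ k, 0 < k → ∀ β, ∀ t ∈ Set.Ioc (0 : ℝ) 1,
        ‖((α : ℝ) + 1) * t ^ α * discSum α k β r (v * t)‖ ≤ (α + 1) * t ^ α := by
      intro k hk β t ht
      have h0 : 0 ≤ ((α : ℝ) + 1) * t ^ α := mul_nonneg (by positivity) (pow_nonneg ht.1.le _)
      rw [norm_mul, Real.norm_of_nonneg h0, Real.norm_eq_abs]
      exact mul_le_of_le_one_right h0 ((ih _ (hvt t ht).1 (hvt t ht).2).1 k hk β)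
    have hcont : ∀ k β, Continuous fun t : ℝ =>
        ((α : ℝ) + 1) * t ^ α * discSum α k β r (v * t) := by
      intro k β; unfold discSum; fun_prop
    constructor
    · intro k hk β
      rw [discSum_succ, ← Real.norm_eq_abs]
      exact (intervalIntegral.norm_integral_le_of_norm_le zero_le_one
        (MeasureTheory.ae_of_all _ (hbound k hk β))
        hii).trans_eq hint
    · simp_rw [discSum_succ]
      suffices h : Tendsto (fun p : ℕ × ℕ => ∫ t in (0 : ℝ)..1,
          ((α : ℝ) + 1) * t ^ α * discSum α p.1 p.2 r (v * t)) (comap Prod.fst atTop)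
          (𝓝 (∫ _ in (0 : ℝ)..1, (0 : ℝ))) by
        simpa only [intervalIntegral.integral_zero] using h
      refine intervalIntegral.tendsto_integral_filter_of_dominated_convergence
        (fun t => ((α : ℝ) + 1) * t ^ α) ?_ ?_ hii ?_
      · exact Eventually.of_forall fun p => (hcont _ _).aestronglyMeasurable
      · filter_upwards [tendsto_comap.eventually (eventually_gt_atTop 0)] with p hp
        refine MeasureTheory.ae_of_all _ fun t ht => ?_
        rw [Set.uIoc_of_le zero_le_one] at ht
        exact hbound p.1 hp p.2 t ht
      · refine MeasureTheory.ae_of_all _ fun t ht => ?_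
        rw [Set.uIoc_of_le zero_le_one] at ht
        simpa using ((ih _ (hvt t ht).1 (hvt t ht).2).2).const_mul (((α : ℝ) + 1) * t ^ α)

open Filter Topology in
lemma discSum_tendsto_of_fixed_degree {r : ℝ} (hr : 0 < r) (hr1 : r < 1) (α k : ℕ) (v : ℝ) :
    Tendsto (fun β => discSum α k β r v) atTop (𝓝 0) := by
  have hterm : ∀ s, Tendsto (fun β => ((k + β).choose s : ℝ) * r ^ (k + β)) atTop (𝓝 0) := by
    intro s
    have h := (tendsto_pow_const_mul_const_pow_of_lt_one s hr.le hr1).comp (tendsto_add_atTop_nat k)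
    refine squeeze_zero (fun β => by positivity) (fun β => ?_) h
    simp only [Function.comp, add_comm β k]
    gcongr
    exact_mod_cast Nat.choose_le_pow (k + β) s
  unfold discSum
  rw [← Finset.sum_const_zero (s := Finset.range (k + 1))]
  refine tendsto_finsetSum _ fun s hs => ?_
  have hs' : s ≤ k := Nat.lt_succ_iff.mp (Finset.mem_range.mp hs)
  have h := (hterm s).const_mul
    ((k.choose s : ℝ) / ((α + s).choose s : ℝ) * (-v) ^ s * r ^ (k - s) * (r ^ s)⁻¹)
  rw [mul_zero] at h
  refine h.congr fun β => ?_
  rw [pow_sub₀ r hr.ne' (show s ≤ k + β by omega)]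
  ring

lemma exists_forall_abs_discSum_lt {r : ℝ} (hr : 0 < r) (hr1 : r < 1) (α : ℕ) {ε : ℝ} (hε : 0 < ε) :
    ∃ T : ℕ, ∀ k β, T ≤ 2 * k + β → |discSum α k β r (1 - r ^ 2)| < ε := by
  have h := (discSum_tendsto hr α (1 - r ^ 2) (by nlinarith) (by linarith)).2
  rw [Metric.tendsto_nhds] at h
  obtain ⟨K, hK⟩ := Filter.eventually_atTop.mp (Filter.eventually_comap.mp (h ε hε))
  have hsmall : ∀ᶠ β in Filter.atTop, ∀ k ∈ Finset.range K, |discSum α k β r (1 - r ^ 2)| < ε := by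
    rw [Filter.eventually_all_finset]
    intro k _
    filter_upwards [Metric.tendsto_nhds.mp
      (discSum_tendsto_of_fixed_degree hr hr1 α k (1 - r ^ 2)) ε hε] with β hβ
    rwa [Real.dist_eq, sub_zero] at hβ
  obtain ⟨B, hB⟩ := Filter.eventually_atTop.mp hsmall
  refine ⟨2 * K + B, fun k β hT => ?_⟩
  rcases lt_or_ge k K with hk | hk
  · exact hB β (by omega) k (Finset.mem_range.mpr hk)
  · simpa [Real.dist_eq] using hK k hk (k, β) rfl

lemma jacobiR_one (α β k : ℕ) : jacobiR α β k 1 = 1 := by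
  have h := pow_mul_jacobiR α β k 1
  norm_num at h
  rw [h, discSum, Finset.sum_eq_single 0]
  · simp
  · intro s _ hs; simp [hs]
  · simp

lemma norm_discR_of_lt_top {q : ℕ∞} (hq : ¬(q = ⊤ ∨ q ≤ 1)) (m n : ℕ) (ξ : ℂ) :
    ‖discR q m n ξ‖ =
      |discSum (q.toNat - 2) (min m n) (max m n - min m n) ‖ξ‖ (1 - ‖ξ‖ ^ 2)| := by
  rw [← pow_mul_jacobiR, discR, if_neg hq, norm_mul, abs_mul, Complex.norm_real, Real.norm_eq_abs,
    abs_of_nonneg (pow_nonneg (norm_nonneg ξ) _)]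
  congr 1
  split_ifs with h
  · rw [norm_pow, max_eq_left h, min_eq_right h]
  · rw [norm_pow, RCLike.norm_conj, max_eq_right (by omega), min_eq_left (by omega)]

lemma exp_mul_I_pow_mul_conj_pow (φ : ℝ) (m n : ℕ) :
    Complex.exp (φ * Complex.I) ^ m * (starRingEnd ℂ (Complex.exp (φ * Complex.I))) ^ n =
      Complex.exp ((((m : ℤ) - (n : ℤ) : ℤ) : ℂ) * φ * Complex.I) := by
  rw [← Complex.exp_conj, ← Complex.exp_nat_mul, ← Complex.exp_nat_mul, ← Complex.exp_add]
  congr 1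
  simp
  ring

lemma discR_exp_mul_I (q : ℕ∞) (m n : ℕ) (φ : ℝ) :
    discR q m n (Complex.exp (φ * Complex.I)) =
      Complex.exp ((((m : ℤ) - (n : ℤ) : ℤ) : ℂ) * φ * Complex.I) := by
  unfold discR
  split_ifs with hq h
  · exact exp_mul_I_pow_mul_conj_pow φ m n
  · rw [Complex.norm_exp_ofReal_mul_I, show (2 * (1 : ℝ) ^ 2 - 1) = 1 by norm_num, jacobiR_one]
    have := exp_mul_I_pow_mul_conj_pow φ (m - n) 0
    simpa [Nat.cast_sub h] using this
  · rw [Complex.norm_exp_ofReal_mul_I, show (2 * (1 : ℝ) ^ 2 - 1) = 1 by norm_num, jacobiR_one]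
    have := exp_mul_I_pow_mul_conj_pow φ 0 (n - m)
    simpa [Nat.cast_sub (not_le.mp h).le] using this

/-- Lemma 2.1 / `lm_Rto0`: for `q ∈ ℕ ∪ {∞}` and `|ξ| < 1`,
`R_{m,n}^{q-2}(ξ) → 0` as `m + n → ∞` along pairs with `m ≠ n`; and on the unit
circle `R_{m,n}^{q-2}(e^{iφ}) = e^{i(m-n)φ}`. -/
theorem stmt7 (q : ℕ∞) (hq : 1 ≤ q) :
    (∀ ξ : ℂ, ‖ξ‖ < 1 → ∀ ε : ℝ, 0 < ε → ∃ T : ℕ,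
      ∀ m n : ℕ, m ≠ n → T ≤ m + n → ‖discR q m n ξ‖ < ε) ∧
    (∀ (φ : ℝ) (m n : ℕ),
      discR q m n (Complex.exp ((φ : ℂ) * Complex.I)) =
        Complex.exp ((((m : ℤ) - (n : ℤ) : ℤ) : ℂ) * (φ : ℂ) * Complex.I)) := by
  refine ⟨fun ξ hξ ε hε => ?_, fun φ m n => discR_exp_mul_I q m n φ⟩
  by_cases hq' : q = ⊤ ∨ q ≤ 1
  · obtain ⟨T, hT⟩ := exists_pow_lt_of_lt_one hε hξ
    refine ⟨T, fun m n _ hmn => ?_⟩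
    rw [discR, if_pos hq', norm_mul, norm_pow, norm_pow, RCLike.norm_conj, ← pow_add]
    exact (pow_le_pow_of_le_one (norm_nonneg _) hξ.le hmn).trans_lt hT
  rcases eq_or_ne ξ 0 with rfl | hξ0
  · refine ⟨0, fun m n hmn _ => ?_⟩
    rw [norm_discR_of_lt_top hq', ← pow_mul_jacobiR, norm_zero, zero_pow (by omega), zero_mul,
      abs_zero]
    exact hε
  · obtain ⟨T, hT⟩ := exists_forall_abs_discSum_lt (norm_pos_iff.mpr hξ0) hξ (q.toNat - 2) hε
    refine ⟨T, fun m n _ hmn => ?_⟩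
    rw [norm_discR_of_lt_top hq']
    exact hT _ _ (by omega)

end
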